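/- Let T be a finite tree such that the eccentric graph E(T) contains a 4-cycle. Then the girth of the eccentric graph E(T □ P_2) equals 4, where P_2 is the path graph on 2 vertices. -/

import Mathlib

open SimpleGraph

/-- The eccentricity of a vertex `v`: the max distance from `v` to any vertex. -/
noncomputable def ecc {V : Type*} [Fintype V] (G : SimpleGraph V) (v : V) : ℕ :=
  Finset.univ.sup fun u => G.dist v u

/-- `u` is eccentric to `v` in `G` if `d(v,u) = e(v)`. -/
def IsEccentric {V : Type*} [Fintype V] (G : SimpleGraph V) (v u : V) : Prop :=
  G.dist v u = ecc G v

/-- The eccentric graph of `G`: distinct `u, v` adjacent iff one is eccentric to the other. -/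
noncomputable def eccGraph {V : Type*} [Fintype V] (G : SimpleGraph V) : SimpleGraph V :=
  SimpleGraph.fromRel fun u v => IsEccentric G u v

/-- The diameter of `G`: the maximum eccentricity. -/
noncomputable def gdiam {V : Type*} [Fintype V] (G : SimpleGraph V) : ℕ :=
  Finset.univ.sup fun v => ecc G v

theorem dist_boxProd_pathGraph_two {V : Type*} {G : SimpleGraph V} (hG : G.Connected)
    (x y : V × Fin 2) :
    (G.boxProd (pathGraph 2)).dist x y = G.dist x.1 y.1 + if x.2 = y.2 then 0 else 1 := by
  have hP : (pathGraph 2).dist x.2 y.2 = if x.2 = y.2 then 0 else 1 := by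
    rw [pathGraph_two_eq_top, dist_top]
  have hc : (pathGraph 2).Connected := pathGraph_connected 1
  rw [← hP, ← Nat.cast_inj (R := ℕ∞), Nat.cast_add,
    ((hG.boxProd hc).preconnected x y).coe_dist_eq_edist,
    (hG.preconnected x.1 y.1).coe_dist_eq_edist,
    (hc.preconnected x.2 y.2).coe_dist_eq_edist, edist_boxProd]

theorem dist_le_ecc {V : Type*} [Fintype V] (G : SimpleGraph V) (v u : V) :
    G.dist v u ≤ ecc G v :=
  Finset.le_sup (f := fun u => G.dist v u) (Finset.mem_univ u)

theorem exists_isEccentric {V : Type*} [Fintype V] (G : SimpleGraph V) (v : V) :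
    ∃ u, IsEccentric G v u := by
  obtain ⟨u, -, hu⟩ := Finset.exists_mem_eq_sup Finset.univ ⟨v, Finset.mem_univ v⟩
    fun u => G.dist v u
  exact ⟨u, hu.symm⟩

theorem ecc_boxProd_pathGraph_two {V : Type*} [Fintype V] {G : SimpleGraph V} (hG : G.Connected)
    (x : V × Fin 2) : ecc (G.boxProd (pathGraph 2)) x = ecc G x.1 + 1 := by
  apply le_antisymm
  · refine Finset.sup_le fun y _ => ?_
    rw [dist_boxProd_pathGraph_two hG]
    exact add_le_add (dist_le_ecc G _ _) (by split_ifs <;> simp)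
  · obtain ⟨u, hu⟩ := exists_isEccentric G x.1
    have h := dist_le_ecc (G.boxProd (pathGraph 2)) x (u, x.2 + 1)
    rwa [dist_boxProd_pathGraph_two hG, hu, if_neg (by simp)] at h

theorem isEccentric_boxProd_pathGraph_two_iff {V : Type*} [Fintype V] {G : SimpleGraph V}
    (hG : G.Connected) (x y : V × Fin 2) :
    IsEccentric (G.boxProd (pathGraph 2)) x y ↔ IsEccentric G x.1 y.1 ∧ x.2 ≠ y.2 := by
  have h := dist_le_ecc G x.1 y.1
  unfold IsEccentric
  rw [ecc_boxProd_pathGraph_two hG, dist_boxProd_pathGraph_two hG]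
  split_ifs with h' <;> simp [h']
  omega

theorem snd_ne_of_eccGraph_boxProd_adj {V : Type*} [Fintype V] {G : SimpleGraph V}
    (hG : G.Connected) {x y : V × Fin 2} (h : (eccGraph (G.boxProd (pathGraph 2))).Adj x y) :
    x.2 ≠ y.2 := by
  rw [eccGraph, fromRel_adj, isEccentric_boxProd_pathGraph_two_iff hG,
    isEccentric_boxProd_pathGraph_two_iff hG] at h
  tauto

theorem eccGraph_boxProd_adj_of_adj {V : Type*} [Fintype V] {G : SimpleGraph V}
    (hG : G.Connected) {u v : V} (h : (eccGraph G).Adj u v) {i j : Fin 2} (hij : i ≠ j) :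
    (eccGraph (G.boxProd (pathGraph 2))).Adj (u, i) (v, j) := by
  rw [eccGraph, fromRel_adj] at h ⊢
  rw [isEccentric_boxProd_pathGraph_two_iff hG, isEccentric_boxProd_pathGraph_two_iff hG]
  exact ⟨fun e => h.1 (congrArg Prod.fst e), h.2.imp (⟨·, hij⟩) (⟨·, hij.symm⟩)⟩

theorem four_le_egirth_of_coloring {W : Type*} {H : SimpleGraph W} (c : H.Coloring Bool) :
    4 ≤ H.egirth := by
  rw [le_egirth]
  intro a w hw
  have h3 := hw.three_le_length
  obtain ⟨k, hk⟩ := (c.even_length_iff_congr w).2 Iff.rfl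
  exact_mod_cast (by omega : 4 ≤ w.length)

theorem egirth_le_four_of_adj {W : Type*} {H : SimpleGraph W} {a b c d : W}
    (hab : H.Adj a b) (hbc : H.Adj b c) (hcd : H.Adj c d) (hda : H.Adj d a)
    (hac : a ≠ c) (hbd : b ≠ d) : H.egirth ≤ 4 := by
  refine egirth_le_length (w := .cons hab (.cons hbc (.cons hcd (.cons hda .nil)))) ?_
  rw [Walk.cons_isCycle_iff]
  simp [Walk.isPath_def, hbc.ne, hcd.ne, hda.ne, hab.ne, hab.ne', hac, hac.symm, hbd]

theorem exists_adj_of_isCycle_of_length_eq_four {W : Type*} {H : SimpleGraph W} {a : W}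
    {w : H.Walk a a} (hw : w.IsCycle) (hl : w.length = 4) :
    ∃ b c d, H.Adj a b ∧ H.Adj b c ∧ H.Adj c d ∧ H.Adj d a ∧ a ≠ c ∧ b ≠ d := by
  match w, hl with
  | .cons hab (.cons hbc (.cons hcd (.cons hda .nil))), _ =>
    have h := hw.support_nodup
    simp at h
    exact ⟨_, _, _, hab, hbc, hcd, hda, by tauto, by tauto⟩

/-- If the eccentric graph of a tree `T` contains a 4-cycle, then the eccentric graph of
`T □ P_2` has girth 4. -/
theorem stmt_12 {V : Type*} [Fintype V] (T : SimpleGraph V) (hT : T.IsTree)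
    (h4 : ∃ (v : V) (c : (eccGraph T).Walk v v), c.IsCycle ∧ c.length = 4) :
    (eccGraph (T.boxProd (pathGraph 2))).egirth = 4 := by
  have hG := hT.connected
  obtain ⟨a, w, hw, hl⟩ := h4
  obtain ⟨b, c, d, hab, hbc, hcd, hda, hac, hbd⟩ := exists_adj_of_isCycle_of_length_eq_four hw hl
  apply le_antisymm
  · exact egirth_le_four_of_adj
      (eccGraph_boxProd_adj_of_adj hG hab (zero_ne_one (α := Fin 2)))
      (eccGraph_boxProd_adj_of_adj hG hbc one_ne_zero)
      (eccGraph_boxProd_adj_of_adj hG hcd zero_ne_one)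
      (eccGraph_boxProd_adj_of_adj hG hda one_ne_zero)
      (by simpa using hac) (by simpa using hbd)
  · exact four_le_egirth_of_coloring (Coloring.mk (fun x => finTwoEquiv x.2) fun h =>
      finTwoEquiv.injective.ne (snd_ne_of_eccGraph_boxProd_adj hG h))
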